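/- Let n be a positive integer. There exists a constant j = j(n) such that for every field K of characteristic zero and every finite subgroup A of GL_n(K), the subgroup generated by the j-th powers of elements of A is abelian. -/

import Mathlib

theorem conj_comm {R : Type*} [NormedRing R] [NormedAlgebra ℂ R] (x b b' : R) (m : ℕ) (hm : 0 < m)
    (hx : x ^ m = 1) (hxn : ∀ i : ℕ, ‖x ^ i‖ ≤ 1) (hb'b : b' * b = 1)
    (hb : ‖b' - 1‖ < 1) (hc : Commute x (b * x * b')) : Commute x b := by
  obtain ⟨ζ, hζ⟩ : ∃ ζ : ℂ, IsPrimitiveRoot ζ m := ⟨_, Complex.isPrimitiveRoot_exp m hm.ne'⟩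
  have hmC : (m : ℂ) ≠ 0 := by exact_mod_cast hm.ne'
  have hζ0 : ζ ≠ 0 := hζ.ne_zero hm.ne'
  set P : ℕ → R := fun k => (m : ℂ)⁻¹ • ∑ i ∈ Finset.range m, ((ζ ^ k)⁻¹ ^ i) • x ^ i with hP
  have hPx : ∀ k, Commute x (P k) := fun k => by
    refine Commute.smul_right (Commute.sum_right _ _ _ fun i _ => ?_) _
    exact ((Commute.refl x).pow_right i).smul_right _
  have hPc : ∀ y, Commute x y → ∀ k, Commute y (P k) := fun y hy k => by
    refine Commute.smul_right (Commute.sum_right _ _ _ fun i _ => ?_) _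
    exact (hy.symm.pow_right i).smul_right _
  have hζk : ∀ k : ℕ, (ζ ^ k) ^ m = 1 := fun k => by
    rw [← pow_mul, mul_comm, pow_mul, hζ.pow_eq_one, one_pow]
  have hxP : ∀ k, x * P k = ζ ^ k • P k := fun k => by
    have hk0 : ζ ^ k ≠ 0 := pow_ne_zero _ hζ0
    have h1 := Finset.sum_range_succ (fun i => ((ζ ^ k)⁻¹ ^ i) • x ^ i) m
    rw [Finset.sum_range_succ'] at h1
    simp only [hx, inv_pow, hζk, pow_zero, inv_one, one_smul] at h1
    have h2 := add_right_cancel h1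
    simp only [hP, inv_pow]
    rw [mul_smul_comm, smul_comm]
    congr 1
    conv_rhs => rw [← h2]
    rw [Finset.mul_sum, Finset.smul_sum]
    refine Finset.sum_congr rfl fun i _ => ?_
    rw [mul_smul_comm, smul_smul, ← pow_succ', pow_succ (ζ ^ k), mul_inv, mul_comm, mul_assoc,
      inv_mul_cancel₀ hk0, mul_one]
  have hsum : ∑ k ∈ Finset.range m, P k = 1 := by
    simp only [hP]
    rw [← Finset.smul_sum, Finset.sum_comm]
    simp_rw [← Finset.sum_smul]
    rw [Finset.sum_eq_single 0]
    · simp [smul_smul, hmC]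
    · intro i hi hi0
      have hz : (ζ ^ i)⁻¹ ≠ 1 := by
        rw [Ne, inv_eq_one]
        exact hζ.pow_ne_one_of_pos_of_lt hi0 (Finset.mem_range.1 hi)
      have : ∑ k ∈ Finset.range m, (ζ ^ k)⁻¹ ^ i = ∑ k ∈ Finset.range m, ((ζ ^ i)⁻¹) ^ k := by
        refine Finset.sum_congr rfl fun k _ => ?_
        rw [inv_pow, inv_pow, ← pow_mul, ← pow_mul, mul_comm]
      rw [this, geom_sum_eq hz, inv_pow, hζk]
      simp
    · intro h; simp at h; omega
  have hPn : ∀ k, ‖P k‖ ≤ 1 := fun k => by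
    have hn1 : ‖ζ‖ = 1 := hζ.norm'_eq_one hm.ne'
    simp only [hP]
    rw [norm_smul, norm_inv, Complex.norm_natCast]
    rw [inv_mul_le_iff₀ (by exact_mod_cast hm), mul_one]
    refine (norm_sum_le _ _).trans ?_
    refine (Finset.sum_le_card_nsmul _ _ 1 fun i _ => ?_).trans (by simp)
    rw [norm_smul]; simpa [hn1] using hxn i
  have hpow : ∀ (z : ℂ) (Y : R), x * Y = z • Y → ∀ i : ℕ, x ^ i * Y = z ^ i • Y := by
    intro z Y h i
    induction i with
    | zero => simp
    | succ i ih => rw [pow_succ, mul_assoc, h, mul_smul_comm, ih, smul_smul, pow_succ']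
  have hPY : ∀ (z : ℂ) (Y : R), x * Y = z • Y → ∀ k, 
      P k * Y = ((m : ℂ)⁻¹ * ∑ i ∈ Finset.range m, ((ζ ^ k)⁻¹ * z) ^ i) • Y := by
    intro z Y h k
    simp only [hP]
    rw [smul_mul_assoc, Finset.sum_mul, mul_smul, Finset.sum_smul]
    congr 1
    refine Finset.sum_congr rfl fun i _ => ?_
    rw [smul_mul_assoc, hpow z Y h, smul_smul, mul_pow]
  have hPsame : ∀ k Y, x * Y = ζ ^ k • Y → P k * Y = Y := by
    intro k Y h
    rw [hPY _ _ h, inv_mul_cancel₀ (pow_ne_zero _ hζ0)]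
    simp [hmC]
  have hPdiff : ∀ k l Y, ζ ^ k ≠ ζ ^ l → x * Y = ζ ^ l • Y → P k * Y = 0 := by
    intro k l Y hkl h
    rw [hPY _ _ h, geom_sum_eq, mul_pow, inv_pow, hζk, hζk]
    · simp
    · intro h; apply hkl; rwa [inv_mul_eq_one₀ (pow_ne_zero _ hζ0)] at h
  have key : ∀ k l, ζ ^ k ≠ ζ ^ l → P k * b * P l = 0 := by
    intro k l hkl
    set X := P k * b * P l with hX
    have e1 : P k * X = X := hPsame k X (by rw [hX, mul_assoc, ← mul_assoc, hxP, smul_mul_assoc])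
    have hcX : b * x * b' * X = ζ ^ l • X := by
      calc b * x * b' * X = (b * x * b' * P k) * b * P l := by rw [hX]; noncomm_ring
        _ = P k * (b * x * (b' * b)) * P l := by rw [(hPc _ hc k).eq]; noncomm_ring
        _ = P k * b * (x * P l) := by rw [hb'b]; noncomm_ring
        _ = _ := by rw [hxP, mul_smul_comm]
    have e2 : P k * (b' * X) = 0 := hPdiff k l _ hkl (by
      calc x * (b' * X) = (b' * b) * x * (b' * X) := by rw [hb'b, one_mul]
        _ = b' * (b * x * b' * X) := by noncomm_ring
        _ = _ := by rw [hcX, mul_smul_comm])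
    have e3 : X = - (P k * ((b' - 1) * X)) := by
      rw [sub_mul, mul_sub, e2, one_mul, e1]; simp
    by_contra hne
    have hXp : 0 < ‖X‖ := norm_pos_iff.2 hne
    have : ‖X‖ ≤ 1 * (‖b' - 1‖ * ‖X‖) := by
      conv_lhs => rw [e3, norm_neg]
      refine (norm_mul_le _ _).trans ?_
      gcongr
      · exact hPn k
      · exact norm_mul_le _ _
    nlinarith
  have hz : ∀ k l, P k * (x * b - b * x) * P l = 0 := by
    intro k l
    have : P k * (x * b - b * x) * P l = (ζ ^ k - ζ ^ l) • (P k * b * P l) := by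
      calc _ = (P k * x) * b * P l - P k * b * (x * P l) := by noncomm_ring
        _ = _ := by rw [← (hPx k).eq, hxP, hxP, sub_smul]; simp [mul_assoc]
    rw [this]
    by_cases h : ζ ^ k = ζ ^ l
    · rw [h, sub_self, zero_smul]
    · rw [key k l h, smul_zero]
  have : x * b - b * x = 0 := by
    calc x * b - b * x = (∑ k ∈ Finset.range m, P k) * (x * b - b * x) * ∑ l ∈ Finset.range m, P l := by
          rw [hsum]; simp
      _ = 0 := by
        rw [Finset.sum_mul, Finset.sum_mul]
        refine Finset.sum_eq_zero fun k _ => ?_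
        rw [Finset.mul_sum]
        exact Finset.sum_eq_zero fun l _ => hz k l
  exact sub_eq_zero.1 this

section
variable {R : Type*} [NormedRing R] [NormedAlgebra ℂ R] {G : Type} [Group G] [Finite G]

theorem near_comm (φ : G →* R) (hφ : ∀ g, ‖φ g‖ ≤ 1) (a b : G)
    (ha : ‖φ a - 1‖ < 1 / 2) (hb : ‖φ b - 1‖ < 1) : Commute (φ a) (φ b) := by
  by_contra hab
  let s : Set G := {b | ‖φ b - 1‖ < 1 ∧ ¬ Commute (φ a) (φ b)}
  have hs : s.Nonempty := ⟨b, hb, hab⟩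
  obtain ⟨c, ⟨hc1, hc2⟩, hmin⟩ := Set.exists_min_image s (fun b => ‖φ b - 1‖) (Set.toFinite s) hs
  have hcinv : φ c * φ c⁻¹ = 1 := by rw [← map_mul]; simp
  have hcinv' : φ c⁻¹ * φ c = 1 := by rw [← map_mul]; simp
  have hainv : φ a * φ a⁻¹ = 1 := by rw [← map_mul]; simp
  have hpos : 0 < ‖φ c - 1‖ := by
    rw [norm_pos_iff, sub_ne_zero]
    intro h
    exact hc2 (h ▸ Commute.one_right _)
  have hlt : ‖φ (c * a * c⁻¹ * a⁻¹) - 1‖ < ‖φ c - 1‖ := by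
    have e : φ (c * a * c⁻¹ * a⁻¹) - 1 =
        ((φ c - 1) * (φ a - 1) - (φ a - 1) * (φ c - 1)) * (φ c⁻¹ * φ a⁻¹) := by
      have h1 : (φ c - 1) * (φ a - 1) - (φ a - 1) * (φ c - 1) = φ c * φ a - φ a * φ c := by
        noncomm_ring
      have h2 : φ a * φ c * (φ c⁻¹ * φ a⁻¹) = 1 := by
        rw [mul_assoc, ← mul_assoc (φ c), hcinv, one_mul, hainv]
      rw [h1, sub_mul, h2]
      simp [mul_assoc]
    rw [e]
    have h3 : ‖φ c⁻¹ * φ a⁻¹‖ ≤ 1 := by rw [← map_mul]; exact hφ _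
    calc _ ≤ ‖(φ c - 1) * (φ a - 1) - (φ a - 1) * (φ c - 1)‖ * ‖φ c⁻¹ * φ a⁻¹‖ := norm_mul_le _ _
      _ ≤ ‖(φ c - 1) * (φ a - 1) - (φ a - 1) * (φ c - 1)‖ * 1 := by gcongr
      _ ≤ ‖φ c - 1‖ * ‖φ a - 1‖ + ‖φ a - 1‖ * ‖φ c - 1‖ := by
        rw [mul_one]
        exact (norm_sub_le _ _).trans (add_le_add (norm_mul_le _ _) (norm_mul_le _ _))
      _ < ‖φ c - 1‖ := by nlinarith
  have hcomm : Commute (φ a) (φ (c * a * c⁻¹ * a⁻¹)) := by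
    by_contra h
    exact absurd (hmin _ ⟨hlt.trans hc1, h⟩) (not_le.2 hlt)
  have hcomm2 : Commute (φ a) (φ c * φ a * φ c⁻¹) := by
    have := hcomm.mul_right (Commute.refl (φ a))
    rwa [← map_mul, inv_mul_cancel_right, map_mul, map_mul] at this
  apply hc2
  refine conj_comm (φ a) (φ c) (φ c⁻¹) (orderOf a) (orderOf_pos a) ?_ ?_ hcinv' ?_ hcomm2
  · rw [← map_pow, pow_orderOf_eq_one, map_one]
  · intro i; rw [← map_pow]; exact hφ _
  · have e : φ c⁻¹ - 1 = - (φ c⁻¹ * (φ c - 1)) := by rw [mul_sub, hcinv']; simp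
    rw [e, norm_neg]
    refine (norm_mul_le _ _).trans_lt ?_
    have := hφ c⁻¹
    nlinarith

theorem exists_near [FiniteDimensional ℝ R] (φ : G →* R) (hφ : ∀ g, ‖φ g‖ ≤ 1)
    (a : G) : ∃ k, 0 < k ∧ k ≤ 5 ^ Module.finrank ℝ R ∧ ‖φ (a ^ k) - 1‖ < 1 / 2 := by
  classical
  by_contra! H
  set N := 5 ^ Module.finrank ℝ R with hN
  have key : ∀ i k, i < k → k ≤ N → 1 ≤ ‖(2 : ℝ) • φ (a ^ i) - (2 : ℝ) • φ (a ^ k)‖ := by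
    intro i k hik hk
    have h1 := H (k - i) (by omega) (by omega)
    have e : φ (a ^ (k - i)) - 1 = φ ((a ^ i)⁻¹) * (φ (a ^ k) - φ (a ^ i)) := by
      rw [mul_sub, ← map_mul, ← map_mul, inv_mul_cancel, map_one, pow_sub a hik.le,
        ((Commute.refl a).pow_pow k i).inv_right.eq]
    have h2 : ‖φ (a ^ (k - i)) - 1‖ ≤ 1 * ‖φ (a ^ k) - φ (a ^ i)‖ := by
      rw [e]
      refine (norm_mul_le _ _).trans ?_
      gcongr
      exact hφ _
    rw [← smul_sub, norm_smul, norm_sub_rev, Real.norm_ofNat]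
    linarith
  let f : ℕ → R := fun i => (2 : ℝ) • φ (a ^ i)
  have key2 : ∀ i ∈ Finset.range (N + 1), ∀ k ∈ Finset.range (N + 1), i ≠ k → 1 ≤ ‖f i - f k‖ := by
    intro i hi k hk hne
    simp only [Finset.mem_range] at hi hk
    rcases lt_or_gt_of_ne hne with h | h
    · exact key i k h (by omega)
    · rw [norm_sub_rev]; exact key k i h (by omega)
  have hinj : Set.InjOn f (Finset.range (N + 1)) := by
    intro i hi k hk h
    by_contra hne
    have := key2 i hi k hk hne
    rw [h, sub_self, norm_zero] at this
    linarith
  have := Besicovitch.card_le_of_separated ((Finset.range (N + 1)).image f)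
    (by
      intro c hc
      obtain ⟨i, -, rfl⟩ := Finset.mem_image.1 hc
      simp only [f, norm_smul, Real.norm_ofNat]
      have := hφ (a ^ i)
      linarith)
    (by
      intro c hc d hd hcd
      obtain ⟨i, hi, rfl⟩ := Finset.mem_image.1 hc
      obtain ⟨k, hk, rfl⟩ := Finset.mem_image.1 hd
      exact key2 i hi k hk (fun h => hcd (h ▸ rfl)))
  rw [Finset.card_image_of_injOn hinj, Finset.card_range] at this
  omega

theorem pow_comm [FiniteDimensional ℝ R] (φ : G →* R) (hφ : ∀ g, ‖φ g‖ ≤ 1)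
    (a b : G) : Commute (φ (a ^ (5 ^ Module.finrank ℝ R).factorial))
      (φ (b ^ (5 ^ Module.finrank ℝ R).factorial)) := by
  obtain ⟨k, hk0, hk, hka⟩ := exists_near φ hφ a
  obtain ⟨l, hl0, hl, hlb⟩ := exists_near φ hφ b
  have h := near_comm φ hφ _ _ hka (hlb.trans (by norm_num))
  obtain ⟨u, hu⟩ := Nat.dvd_factorial hk0 hk
  obtain ⟨v, hv⟩ := Nat.dvd_factorial hl0 hl
  have ea : φ (a ^ (5 ^ Module.finrank ℝ R).factorial) = φ (a ^ k) ^ u := by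
    rw [hu, pow_mul, map_pow]
  have eb : φ (b ^ (5 ^ Module.finrank ℝ R).factorial) = φ (b ^ l) ^ v := by
    rw [hv, pow_mul, map_pow]
  rw [ea, eb]
  exact h.pow_pow u v
end

open scoped Matrix.Norms.L2Operator in
theorem matrix_pow_comm (n : ℕ) (hn : 0 < n) (G : Type) [Group G] [Finite G]
    (φ : G →* Matrix (Fin n) (Fin n) ℂ)
    (hφ : ∀ g, φ g ∈ unitary (Matrix (Fin n) (Fin n) ℂ)) (a b : G) :
    Commute (φ (a ^ (5 ^ Module.finrank ℝ (Matrix (Fin n) (Fin n) ℂ)).factorial))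
      (φ (b ^ (5 ^ Module.finrank ℝ (Matrix (Fin n) (Fin n) ℂ)).factorial)) := by
  have : Nonempty (Fin n) := ⟨⟨0, hn⟩⟩
  exact pow_comm φ (fun g => (CStarRing.norm_of_mem_unitary (hφ g)).le) a b

theorem exists_hom_complex (F : Type) [Field F] [CharZero F] [Countable F] : Nonempty (F →+* ℂ) := by
  obtain ⟨s, hs⟩ := exists_isTranscendenceBasis ℚ F
  obtain ⟨t, ht⟩ := exists_isTranscendenceBasis ℚ ℂ
  have hcard := IsAlgClosed.cardinal_eq_cardinal_transcendence_basis_of_aleph0_lt' _ ht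
    (by simp) (by simp [Cardinal.aleph0_lt_continuum])
  have hle : Cardinal.mk s ≤ Cardinal.mk t := by
    rw [← hcard]
    refine (Cardinal.mk_le_aleph0).trans ?_
    simp [Cardinal.aleph0_le_continuum]
  obtain ⟨e⟩ := hle
  have hw : AlgebraicIndependent ℚ (fun i : s => ((e i : t) : ℂ)) := ht.1.comp e e.injective
  let f : Algebra.adjoin ℚ (Set.range ((↑) : s → F)) →+* ℂ :=
    ((MvPolynomial.aeval (R := ℚ) (fun i : s => ((e i : t) : ℂ))).comp
      hs.1.aevalEquiv.symm.toAlgHom).toRingHom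
  have hf : Function.Injective f := by
    have : Function.Injective (MvPolynomial.aeval (R := ℚ) (fun i : s => ((e i : t) : ℂ))) := hw
    exact this.comp hs.1.aevalEquiv.symm.injective
  let := f.toAlgebra
  have : Algebra.IsAlgebraic (Algebra.adjoin ℚ (Set.range ((↑) : s → F))) F := hs.isAlgebraic
  have : FaithfulSMul (Algebra.adjoin ℚ (Set.range ((↑) : s → F))) ℂ :=
    (faithfulSMul_iff_algebraMap_injective _ _).2 hf
  have : Module.IsTorsionFree (Algebra.adjoin ℚ (Set.range ((↑) : s → F))) ℂ := inferInstance
  exact ⟨(IsAlgClosed.lift (R := Algebra.adjoin ℚ (Set.range ((↑) : s → F))) (S := F) (M := ℂ)).toRingHom⟩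

theorem hom_of_finite (n : ℕ) (K : Type) [Field K] [CharZero K] 
    (A : Subgroup (Matrix.GeneralLinearGroup (Fin n) K)) (hA : Finite A) :
    ∃ φ : A →* Matrix (Fin n) (Fin n) ℂ, Function.Injective φ := by
  let S : Set K := ⋃ (g : A), ⋃ (i : Fin n), ⋃ (j : Fin n), {((g : Matrix.GeneralLinearGroup (Fin n) K) : Matrix (Fin n) (Fin n) K) i j}
  have hS : S.Countable := by
    refine Set.countable_iUnion fun _ => Set.countable_iUnion fun _ => Set.countable_iUnion fun _ => 
      Set.countable_singleton _
  have hc : Countable (Subfield.closure S) := by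
    rw [← Cardinal.mk_le_aleph0_iff]
    exact (Subfield.cardinalMk_closure_le_max S).trans (max_le (Cardinal.mk_le_aleph0_iff.2 hS) le_rfl)
  have : CharZero (Subfield.closure S) := inferInstance
  obtain ⟨ψ⟩ := exists_hom_complex (Subfield.closure S)
  have hmem : ∀ (g : A) i j, ((g : Matrix.GeneralLinearGroup (Fin n) K) : Matrix (Fin n) (Fin n) K) i j ∈ Subfield.closure S := by
    intro g i j
    refine Subfield.subset_closure ?_
    simp only [S, Set.mem_iUnion]
    exact ⟨g, i, j, rfl⟩
  let φ₀ : A →* Matrix (Fin n) (Fin n) (Subfield.closure S) := 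
   { toFun := fun g => Matrix.of fun i j => ⟨_, hmem g i j⟩
     map_one' := by
      ext i j
      simp [Matrix.one_apply, apply_ite]
     map_mul' := fun g h => by
      ext i j
      simp [Matrix.mul_apply] }
  refine ⟨(ψ.mapMatrix.toMonoidHom).comp φ₀, ?_⟩
  intro g h hgh
  ext i j
  have := congrFun (congrFun hgh i) j
  simp [φ₀] at this
  exact congrArg Subtype.val (ψ.injective this)

open scoped ComplexOrder MatrixOrder Matrix in
theorem unitarize (n : ℕ) (G : Type) [Group G] [Finite G] (φ : G →* Matrix (Fin n) (Fin n) ℂ) 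
    (hφ : Function.Injective φ) :
    ∃ φ' : G →* Matrix (Fin n) (Fin n) ℂ, Function.Injective φ' ∧ 
      ∀ g, φ' g ∈ unitary (Matrix (Fin n) (Fin n) ℂ) := by
  classical
  have := Fintype.ofFinite G
  let S := ∑ g : G, (φ g)ᴴ * φ g
  have hinv : ∀ h, (φ h)ᴴ * S * φ h = S := by
    intro h
    simp only [S, Finset.mul_sum, Finset.sum_mul]
    refine Fintype.sum_equiv (Equiv.mulRight h) _ _ fun g => ?_
    simp [Matrix.mul_assoc]
  have hps : S.PosDef := by
    have h1 : S = 1 + ∑ g ∈ Finset.univ.erase 1, (φ g)ᴴ * φ g := by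
      simp only [S]
      rw [← Finset.add_sum_erase _ _ (Finset.mem_univ (1 : G))]
      simp
    rw [h1]
    exact Matrix.PosDef.one.add_posSemidef (Matrix.posSemidef_sum _ fun g _ => Matrix.posSemidef_conjTranspose_mul_self _)
  obtain ⟨B, hB⟩ := CStarAlgebra.nonneg_iff_eq_star_mul_self.mp hps.posSemidef.nonneg
  have hBu : IsUnit B := by
    have := hps.isUnit
    rw [hB, Matrix.isUnit_iff_isUnit_det, Matrix.det_mul] at this
    rw [Matrix.isUnit_iff_isUnit_det]
    exact isUnit_of_mul_isUnit_right this
  obtain ⟨u, rfl⟩ := hBu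
  let φ' : G →* Matrix (Fin n) (Fin n) ℂ := 
    { toFun := fun g => u * φ g * ((u⁻¹ : _ˣ) : Matrix (Fin n) (Fin n) ℂ)
      map_one' := by simp
      map_mul' := fun g h => by simp [mul_assoc] }
  have hun : ∀ g, star (φ' g) * φ' g = 1 := by
    intro g
    have e : star (φ' g) * φ' g = star ((u⁻¹ : _ˣ) : Matrix (Fin n) (Fin n) ℂ) * ((φ g)ᴴ * S * φ g)
      * ((u⁻¹ : _ˣ) : Matrix (Fin n) (Fin n) ℂ) := by
      rw [hB]; simp [φ', star_mul, mul_assoc, Matrix.star_eq_conjTranspose]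
    rw [e, hinv, hB, ← mul_assoc, ← star_mul]; simp
  refine ⟨φ', fun g h hgh => hφ ?_, fun g => ?_⟩
  · exact u.isUnit.mul_left_cancel ((u⁻¹).isUnit.mul_right_cancel hgh)
  · exact ⟨hun g, mul_eq_one_comm.1 (hun g)⟩


/-- Jordan's theorem: for each `n` there is a constant `j = j(n)` such that for every
finite subgroup `A` of `GL_n(K)` over a characteristic-zero field `K`, the subgroup
generated by `j`-th powers of elements of `A` is abelian. -/
theorem jordan_powers_abelian (n : ℕ) (hn : 0 < n) :
    ∃ j : ℕ, 0 < j ∧ ∀ (K : Type) [Field K] [CharZero K]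
      (A : Subgroup (Matrix.GeneralLinearGroup (Fin n) K)), Finite A →
      ∀ x ∈ Subgroup.closure ((fun a => a ^ j) '' (A : Set (Matrix.GeneralLinearGroup (Fin n) K))),
      ∀ y ∈ Subgroup.closure ((fun a => a ^ j) '' (A : Set (Matrix.GeneralLinearGroup (Fin n) K))),
        x * y = y * x := by
  refine ⟨(5 ^ Module.finrank ℝ (Matrix (Fin n) (Fin n) ℂ)).factorial, Nat.factorial_pos _, ?_⟩
  intro K _ _ A hA x hx y hy
  obtain ⟨φ₀, hφ₀⟩ := hom_of_finite n K A hA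
  obtain ⟨φ, hφ, hu⟩ := unitarize n A φ₀ hφ₀
  refine Subgroup.closure_induction₂ (p := fun x y _ _ => Commute x y) ?_ ?_ ?_ ?_ ?_ ?_ ?_ hx hy
  · rintro _ _ ⟨a, ha, rfl⟩ ⟨b, hb, rfl⟩
    have h := matrix_pow_comm n hn A φ hu ⟨a, ha⟩ ⟨b, hb⟩
    have h2 := hφ (by simpa only [map_mul] using h.eq :
      φ (⟨a, ha⟩ ^ _ * ⟨b, hb⟩ ^ _) = φ (⟨b, hb⟩ ^ _ * ⟨a, ha⟩ ^ _))
    exact congrArg Subtype.val h2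
  · intro x _; exact Commute.one_left x
  · intro x _; exact Commute.one_right x
  · intro x y z _ _ _ h1 h2; exact h1.mul_left h2
  · intro x y z _ _ _ h1 h2; exact h1.mul_right h2
  · intro x y _ _ h; exact h.inv_left
  · intro x y _ _ h; exact h.inv_right
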